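/- Let m = ⊕_{p<0} g_p be a fundamental graded Lie algebra of the μ-th kind over ℂ with μ = 2 or μ = 3, and let g(m) = ⊕_{p∈ℤ} g(m)_p be the prolongation of m. If g(m)_0 is isomorphic to gl(g_{-1}) (via the restriction map D ↦ D|g_{-1}), then m is a free fundamental graded Lie algebra. -/

import Mathlib

open scoped TensorProduct

/-- A ℤ-graded Lie algebra (GLA) structure over `ℂ` on a Lie algebra `L`:
a family of finite-dimensional subspaces forming an internal direct sum and
compatible with the bracket. -/
structure GLA (L : Type) [LieRing L] [LieAlgebra ℂ L] : Type where
  g : ℤ → Submodule ℂ L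
  internal : DirectSum.IsInternal g
  bracket_mem : ∀ p q : ℤ, ∀ x ∈ g p, ∀ y ∈ g q, ⁅x, y⁆ ∈ g (p + q)
  findim : ∀ p : ℤ, FiniteDimensional ℂ (g p)

namespace GLA

variable {L : Type} [LieRing L] [LieAlgebra ℂ L]

/-- A GLA is a fundamental graded Lie algebra (FGLA): it is finite-dimensional,
concentrated in negative degrees, `g₋₁ ≠ 0`, and it is generated by `g₋₁`
(i.e. `g_{p-1} = [g_p, g₋₁]` for all `p < 0`). -/
structure IsFGLA (G : GLA L) : Prop where
  fd : FiniteDimensional ℂ L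
  nonneg : ∀ p : ℤ, 0 ≤ p → G.g p = ⊥
  neg_one_ne_bot : G.g (-1) ≠ ⊥
  generated : ∀ p : ℤ, p < 0 →
    G.g (p - 1) = Submodule.span ℂ {z : L | ∃ x ∈ G.g p, ∃ y ∈ G.g (-1), z = ⁅x, y⁆}

/-- A GLA is of the `μ`-th kind (equivalently, of depth `μ`). -/
def IsOfKind (G : GLA L) (μ : ℕ) : Prop :=
  G.g (-(μ : ℤ)) ≠ ⊥ ∧ ∀ p : ℤ, p < -(μ : ℤ) → G.g p = ⊥

/-- Transitivity of a GLA. -/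
def Transitive (G : GLA L) : Prop :=
  ∀ p : ℤ, 0 ≤ p → ∀ x ∈ G.g p,
    (∀ q : ℤ, q < 0 → ∀ y ∈ G.g q, ⁅x, y⁆ = 0) → x = 0

end GLA

/-- `G` is a free fundamental graded Lie algebra of type `(n, μ)`:
it is an FGLA of the `μ`-th kind with `dim g₋₁ = n`, and every surjective linear map
from `g₋₁` onto the degree `-1` part of an FGLA of the `μ`-th kind extends uniquely
to a graded Lie algebra epimorphism. -/
def IsFreeFGLA {L : Type} [LieRing L] [LieAlgebra ℂ L] (G : GLA L) (n μ : ℕ) : Prop :=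
  G.IsFGLA ∧ G.IsOfKind μ ∧ Module.finrank ℂ (G.g (-1)) = n ∧
  ∀ (L' : Type) [LieRing L'] [LieAlgebra ℂ L'] (G' : GLA L'),
    G'.IsFGLA → G'.IsOfKind μ →
    ∀ φ : (G.g (-1)) →ₗ[ℂ] (G'.g (-1)), Function.Surjective φ →
      ∃! Φ : L →ₗ⁅ℂ⁆ L',
        (∀ p : ℤ, ∀ x ∈ G.g p, Φ x ∈ G'.g p) ∧ Function.Surjective Φ ∧
        ∀ x : G.g (-1), Φ (x : L) = (φ x : L')

/-- A pseudo-product FGLA: an FGLA together with nonzero subspaces `e`, `f` with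
`g₋₁ = e ⊕ f` and `[e,e] = [f,f] = 0`. -/
structure IsPPFGLA {L : Type} [LieRing L] [LieAlgebra ℂ L]
    (G : GLA L) (e f : Submodule ℂ L) : Prop where
  fgla : G.IsFGLA
  e_ne_bot : e ≠ ⊥
  f_ne_bot : f ≠ ⊥
  sup_eq : e ⊔ f = G.g (-1)
  inf_eq : e ⊓ f = ⊥
  lie_ee : ∀ x ∈ e, ∀ y ∈ e, ⁅x, y⁆ = (0 : L)
  lie_ff : ∀ x ∈ f, ∀ y ∈ f, ⁅x, y⁆ = (0 : L)

/-- `(G; e, f)` is a free pseudo-product FGLA of type `(m, n, μ)`. -/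
def IsFreePPFGLA {L : Type} [LieRing L] [LieAlgebra ℂ L] (G : GLA L)
    (e f : Submodule ℂ L) (m n μ : ℕ) : Prop :=
  IsPPFGLA G e f ∧ G.IsOfKind μ ∧
  Module.finrank ℂ e = m ∧ Module.finrank ℂ f = n ∧
  ∀ (L' : Type) [LieRing L'] [LieAlgebra ℂ L'] (G' : GLA L') (e' f' : Submodule ℂ L'),
    IsPPFGLA G' e' f' → G'.IsOfKind μ →
    ∀ φ : (G.g (-1)) →ₗ[ℂ] (G'.g (-1)), Function.Surjective φ →
      (∀ x : L, ∀ hx : x ∈ G.g (-1), x ∈ e → (φ ⟨x, hx⟩ : L') ∈ e') →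
      (∀ x : L, ∀ hx : x ∈ G.g (-1), x ∈ f → (φ ⟨x, hx⟩ : L') ∈ f') →
      ∃! Φ : L →ₗ⁅ℂ⁆ L',
        (∀ p : ℤ, ∀ x ∈ G.g p, Φ x ∈ G'.g p) ∧ Function.Surjective Φ ∧
        ∀ x : G.g (-1), Φ (x : L) = (φ x : L')

/-- `G` (on `LG`, with embedding `ι` of `Lm`) is the prolongation of the FGLA `M`:
`ι` embeds `M` as the negative part of `G`, `G` is transitive, and `G` is maximal among
transitive GLAs with negative part `M`. -/
structure IsProlongation {Lm LG : Type} [LieRing Lm] [LieAlgebra ℂ Lm]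
    [LieRing LG] [LieAlgebra ℂ LG] (M : GLA Lm) (G : GLA LG)
    (ι : Lm →ₗ⁅ℂ⁆ LG) : Prop where
  inj : Function.Injective ι
  graded_neg : ∀ p : ℤ, p < 0 → (M.g p).map ι.toLinearMap = G.g p
  trans : G.Transitive
  max : ∀ (LH : Type) [LieRing LH] [LieAlgebra ℂ LH] (H : GLA LH) (j : Lm →ₗ⁅ℂ⁆ LH),
    Function.Injective j → (∀ p : ℤ, p < 0 → (M.g p).map j.toLinearMap = H.g p) →
    H.Transitive →
    ∃ ψ : LH →ₗ⁅ℂ⁆ LG, Function.Injective ψ ∧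
      (∀ p : ℤ, (H.g p).map ψ.toLinearMap ≤ G.g p) ∧ ψ.comp j = ι

/-- `G` (with embedding `ι`) is the prolongation of the pseudo-product FGLA `(M; e, f)`:
the negative part is `M`, `G` is transitive, the degree-0 part preserves `e` and `f`,
and `G` is maximal among such transitive GLAs. -/
structure IsPPProlongation {Lm LG : Type} [LieRing Lm] [LieAlgebra ℂ Lm]
    [LieRing LG] [LieAlgebra ℂ LG] (M : GLA Lm) (e f : Submodule ℂ Lm) (G : GLA LG)
    (ι : Lm →ₗ⁅ℂ⁆ LG) : Prop where
  inj : Function.Injective ι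
  graded_neg : ∀ p : ℤ, p < 0 → (M.g p).map ι.toLinearMap = G.g p
  trans : G.Transitive
  e_stable : ∀ x ∈ G.g 0, ∀ y ∈ e, ⁅x, ι y⁆ ∈ e.map ι.toLinearMap
  f_stable : ∀ x ∈ G.g 0, ∀ y ∈ f, ⁅x, ι y⁆ ∈ f.map ι.toLinearMap
  max : ∀ (LH : Type) [LieRing LH] [LieAlgebra ℂ LH] (H : GLA LH) (j : Lm →ₗ⁅ℂ⁆ LH),
    Function.Injective j → (∀ p : ℤ, p < 0 → (M.g p).map j.toLinearMap = H.g p) →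
    H.Transitive →
    (∀ x ∈ H.g 0, ∀ y ∈ e, ⁅x, j y⁆ ∈ e.map j.toLinearMap) →
    (∀ x ∈ H.g 0, ∀ y ∈ f, ⁅x, j y⁆ ∈ f.map j.toLinearMap) →
    ∃ ψ : LH →ₗ⁅ℂ⁆ LG, Function.Injective ψ ∧
      (∀ p : ℤ, (H.g p).map ψ.toLinearMap ≤ G.g p) ∧ ψ.comp j = ι

/-- `G` is a finite-dimensional simple graded Lie algebra of type `(A, Pi1)`, where `A`
is the Cartan matrix (with convention `⁅hᵢ, eⱼ⁆ = Aᵢⱼ • eⱼ`) and `Pi1` is the set of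
simple roots of degree one: there is a set of Chevalley generators compatible with the
grading, the generators `eᵢ` (resp. `fᵢ`) having degree `1` (resp. `-1`) for `i ∈ Pi1`
and degree `0` otherwise. -/
def IsSimpleGLAOfType {LG : Type} [LieRing LG] [LieAlgebra ℂ LG] (G : GLA LG)
    {l : ℕ} (A : Matrix (Fin l) (Fin l) ℤ) (Pi1 : Finset (Fin l)) : Prop :=
  FiniteDimensional ℂ LG ∧ LieAlgebra.IsSimple ℂ LG ∧
  ∃ h e f : Fin l → LG,
    LinearIndependent ℂ h ∧ (∀ i, e i ≠ 0) ∧ (∀ i, f i ≠ 0) ∧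
    (∀ i j, ⁅h i, h j⁆ = 0) ∧
    (∀ i, ⁅e i, f i⁆ = h i) ∧ (∀ i j, i ≠ j → ⁅e i, f j⁆ = 0) ∧
    (∀ i j, ⁅h i, e j⁆ = A i j • e j) ∧
    (∀ i j, ⁅h i, f j⁆ = (-(A i j)) • f j) ∧
    LieSubalgebra.lieSpan ℂ LG (Set.range e ∪ Set.range f) = ⊤ ∧
    (∀ i, h i ∈ G.g 0) ∧
    (∀ i, e i ∈ G.g (if i ∈ Pi1 then 1 else 0)) ∧
    (∀ i, f i ∈ G.g (-(if i ∈ Pi1 then 1 else 0)))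

/-- The Cartan matrix of type `A_l` (Bourbaki numbering, 0-indexed). -/
def cartanA (l : ℕ) : Matrix (Fin l) (Fin l) ℤ :=
  Matrix.of fun i j =>
    if i = j then 2
    else if (i : ℕ) + 1 = (j : ℕ) ∨ (j : ℕ) + 1 = (i : ℕ) then -1 else 0

/-- The Cartan matrix of type `B_l` (Bourbaki numbering, 0-indexed; the last simple
root is the short one), with convention `⁅hᵢ, eⱼ⁆ = Aᵢⱼ • eⱼ`, i.e. `Aᵢⱼ = αⱼ(hᵢ)`. -/
def cartanB (l : ℕ) : Matrix (Fin l) (Fin l) ℤ :=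
  Matrix.of fun i j =>
    if i = j then 2
    else if (i : ℕ) = l - 1 ∧ (j : ℕ) + 1 = (i : ℕ) then -2
    else if (i : ℕ) + 1 = (j : ℕ) ∨ (j : ℕ) + 1 = (i : ℕ) then -1 else 0

/-- The Cartan matrix of type `G₂` (Bourbaki numbering, 0-indexed; `α₁` is the short
root), with convention `⁅hᵢ, eⱼ⁆ = Aᵢⱼ • eⱼ`, i.e. `Aᵢⱼ = αⱼ(hᵢ)`. -/
def cartanG2 : Matrix (Fin 2) (Fin 2) ℤ := !![2, -3; -1, 2]

/-- A pseudo-product graded Lie algebra: a transitive GLA whose negative part is an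
FGLA equipped with a pseudo-product structure `(e, f)` preserved by `g₀`. -/
structure IsPseudoProductGLA {L : Type} [LieRing L] [LieAlgebra ℂ L]
    (G : GLA L) (e f : Submodule ℂ L) : Prop where
  trans : G.Transitive
  e_ne_bot : e ≠ ⊥
  f_ne_bot : f ≠ ⊥
  sup_eq : e ⊔ f = G.g (-1)
  inf_eq : e ⊓ f = ⊥
  lie_ee : ∀ x ∈ e, ∀ y ∈ e, ⁅x, y⁆ = (0 : L)
  lie_ff : ∀ x ∈ f, ∀ y ∈ f, ⁅x, y⁆ = (0 : L)
  neg_one_ne_bot : G.g (-1) ≠ ⊥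
  generated : ∀ p : ℤ, p < 0 →
    G.g (p - 1) = Submodule.span ℂ {z : L | ∃ x ∈ G.g p, ∃ y ∈ G.g (-1), z = ⁅x, y⁆}
  depth_bdd : ∃ μ : ℕ, ∀ p : ℤ, p < -(μ : ℤ) → G.g p = ⊥
  e_stable : ∀ x ∈ G.g 0, ∀ y ∈ e, ⁅x, y⁆ ∈ e
  f_stable : ∀ x ∈ G.g 0, ∀ y ∈ f, ⁅x, y⁆ ∈ f

/-- The symmetric square `S²(V)` of a vector space, realized as the subspace of
symmetric tensors in `V ⊗ V`. -/
noncomputable def symSq (V : Type) [AddCommGroup V] [Module ℂ V] : Submodule ℂ (TensorProduct ℂ V V) :=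
  LinearMap.eqLocus (TensorProduct.comm ℂ V V).toLinearMap LinearMap.id

lemma tmul_self_mem_symSq {V : Type} [AddCommGroup V] [Module ℂ V] (x : V) :
    x ⊗ₜ[ℂ] x ∈ symSq V := by
  show (TensorProduct.comm ℂ V V).toLinearMap (x ⊗ₜ[ℂ] x) = LinearMap.id (x ⊗ₜ[ℂ] x)
  simp

namespace LieTensor

variable {K V L : Type*} [Field K] [AddCommGroup V] [Module K V] [LieRing L] [LieAlgebra K L]

/-- The linear map `x ⊗ y ↦ ⁅ψ x, ψ y⁆`. -/
noncomputable def bracket₂ (ψ : V →ₗ[K] L) : V ⊗[K] V →ₗ[K] L :=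
  TensorProduct.lift ((LieModule.toEnd K L L : L →ₗ[K] Module.End K L).compl₁₂ ψ ψ)

/-- The linear map `(x ⊗ y) ⊗ z ↦ ⁅⁅ψ x, ψ y⁆, ψ z⁆`. -/
noncomputable def bracket₃ (ψ : V →ₗ[K] L) : (V ⊗[K] V) ⊗[K] V →ₗ[K] L :=
  TensorProduct.lift ((LieModule.toEnd K L L : L →ₗ[K] Module.End K L).compl₁₂ (bracket₂ ψ) ψ)

/-- The sum of `ψ`, `bracket₂ ψ` and `bracket₃ ψ`. -/
noncomputable def bracketSum (ψ : V →ₗ[K] L) :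
    V × (V ⊗[K] V) × ((V ⊗[K] V) ⊗[K] V) →ₗ[K] L :=
  ψ.coprod ((bracket₂ ψ).coprod (bracket₃ ψ))

@[simp]
lemma bracket₂_tmul (ψ : V →ₗ[K] L) (x y : V) : bracket₂ ψ (x ⊗ₜ y) = ⁅ψ x, ψ y⁆ := by
  simp [bracket₂]

@[simp]
lemma bracket₃_tmul (ψ : V →ₗ[K] L) (t : V ⊗[K] V) (z : V) :
    bracket₃ ψ (t ⊗ₜ z) = ⁅bracket₂ ψ t, ψ z⁆ := by
  simp [bracket₃]

@[simp]
lemma bracketSum_apply (ψ : V →ₗ[K] L) (a : V) (b : V ⊗[K] V) (c : (V ⊗[K] V) ⊗[K] V) :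
    bracketSum ψ (a, b, c) = ψ a + (bracket₂ ψ b + bracket₃ ψ c) := by
  simp [bracketSum]

lemma comp_bracket₂ {L' : Type*} [LieRing L'] [LieAlgebra K L'] (f : L →ₗ⁅K⁆ L')
    (ψ : V →ₗ[K] L) (t : V ⊗[K] V) :
    f (bracket₂ ψ t) = bracket₂ (f.toLinearMap ∘ₗ ψ) t := by
  induction t with
  | zero => simp
  | tmul x y => simp
  | add x y hx hy => simp [hx, hy]

lemma comp_bracket₃ {L' : Type*} [LieRing L'] [LieAlgebra K L'] (f : L →ₗ⁅K⁆ L')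
    (ψ : V →ₗ[K] L) (t : (V ⊗[K] V) ⊗[K] V) :
    f (bracket₃ ψ t) = bracket₃ (f.toLinearMap ∘ₗ ψ) t := by
  induction t with
  | zero => simp
  | tmul x y => simp [comp_bracket₂]
  | add x y hx hy => simp [hx, hy]

lemma comp_bracketSum {L' : Type*} [LieRing L'] [LieAlgebra K L'] (f : L →ₗ⁅K⁆ L')
    (ψ : V →ₗ[K] L) (t : V × (V ⊗[K] V) × ((V ⊗[K] V) ⊗[K] V)) :
    f (bracketSum ψ t) = bracketSum (f.toLinearMap ∘ₗ ψ) t := by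
  obtain ⟨a, b, c⟩ := t
  simp [comp_bracket₂, comp_bracket₃]

/-- The bilinear form `(ξ, η)` evaluated on a tensor. -/
noncomputable def eval₂ (ξ η : Module.Dual K V) : V ⊗[K] V →ₗ[K] K :=
  LinearMap.mul' K K ∘ₗ TensorProduct.map ξ η

/-- The trilinear form `(ξ, η, ζ)` evaluated on a tensor. -/
noncomputable def eval₃ (ξ η ζ : Module.Dual K V) : (V ⊗[K] V) ⊗[K] V →ₗ[K] K :=
  LinearMap.mul' K K ∘ₗ TensorProduct.map (eval₂ ξ η) ζ

@[simp]
lemma eval₂_tmul (ξ η : Module.Dual K V) (x y : V) : eval₂ ξ η (x ⊗ₜ y) = ξ x * η y := by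
  simp [eval₂]

@[simp]
lemma eval₃_tmul (ξ η ζ : Module.Dual K V) (t : V ⊗[K] V) (z : V) :
    eval₃ ξ η ζ (t ⊗ₜ z) = eval₂ ξ η t * ζ z := by
  simp [eval₃]

lemma ext_eval₂ [FiniteDimensional K V] {s t : V ⊗[K] V}
    (h : ∀ ξ η, eval₂ ξ η s = eval₂ ξ η t) : s = t := by
  let b := Module.finBasis K V
  refine (b.tensorProduct b).ext_elem fun ⟨i, j⟩ ↦ ?_
  have key : ∀ t, (b.tensorProduct b).repr t (i, j) = eval₂ (b.coord i) (b.coord j) t := by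
    intro t
    induction t with
    | zero => simp
    | tmul x y => simp [mul_comm]
    | add x y hx hy => simp [hx, hy]
  rw [key, key, h]

lemma ext_eval₃ [FiniteDimensional K V] {s t : (V ⊗[K] V) ⊗[K] V}
    (h : ∀ ξ η ζ, eval₃ ξ η ζ s = eval₃ ξ η ζ t) : s = t := by
  let b := Module.finBasis K V
  refine ((b.tensorProduct b).tensorProduct b).ext_elem fun ⟨⟨i, j⟩, k⟩ ↦ ?_
  have key : ∀ t, ((b.tensorProduct b).tensorProduct b).repr t ((i, j), k)
      = eval₃ (b.coord i) (b.coord j) (b.coord k) t := by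
    intro t
    induction t with
    | zero => simp
    | tmul t z =>
      induction t with
      | zero => simp
      | tmul x y => simp; ring
      | add x y hx hy => simp_all [TensorProduct.add_tmul]
    | add x y hx hy => simp [hx, hy]
  rw [key, key, h]

/-- The endomorphisms of `V` which are induced, along `ψ`, by inner derivations of `L`. -/
def Induced (ψ : V →ₗ[K] L) (X : L) (A : Module.End K V) : Prop :=
  ∀ v, ⁅X, ψ v⁆ = ψ (A v)

lemma Induced.lie₂ {ψ : V →ₗ[K] L} {X : L} {A : Module.End K V} (h : Induced ψ X A) (x y : V) :
    ⁅X, ⁅ψ x, ψ y⁆⁆ = ⁅ψ (A x), ψ y⁆ + ⁅ψ x, ψ (A y)⁆ := by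
  rw [leibniz_lie, h, h]

lemma Induced.lie₃ {ψ : V →ₗ[K] L} {X : L} {A : Module.End K V} (h : Induced ψ X A)
    (x y z : V) :
    ⁅X, ⁅⁅ψ x, ψ y⁆, ψ z⁆⁆ =
      ⁅⁅ψ (A x), ψ y⁆, ψ z⁆ + ⁅⁅ψ x, ψ (A y)⁆, ψ z⁆ + ⁅⁅ψ x, ψ y⁆, ψ (A z)⁆ := by
  rw [leibniz_lie, h, h.lie₂, add_lie]

variable {ψ : V →ₗ[K] L}

lemma eval₂_sub_smul (hψ : ∀ A : Module.End K V, ∃ X, Induced ψ X A) {t : V ⊗[K] V}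
    (ht : bracket₂ ψ t = 0) (ξ η : Module.Dual K V) (u v : V) :
    (eval₂ ξ η t - eval₂ η ξ t) • ⁅ψ u, ψ v⁆ = 0 := by
  choose X hX using hψ
  let A : Module.End K V := ξ.smulRight u
  let B : Module.End K V := η.smulRight v
  have key : ∀ t, ⁅X A, ⁅X B, bracket₂ ψ t⁆⁆ - ⁅X (A * B), bracket₂ ψ t⁆ =
      (eval₂ ξ η t - eval₂ η ξ t) • ⁅ψ u, ψ v⁆ := by
    intro t
    induction t with
    | zero => simp
    | tmul x y =>
      simp only [bracket₂_tmul, (hX _).lie₂, lie_add, Module.End.mul_apply, eval₂_tmul]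
      simp only [A, B, LinearMap.smulRight_apply, map_smul, smul_lie, lie_smul,
        ← lie_skew (ψ u) (ψ v)]
      module
    | add x y hx hy =>
      simp only [map_add, lie_add]
      linear_combination (norm := module) hx + hy
  simpa [ht] using (key t).symm

lemma eval₃_sub_smul (hψ : ∀ A : Module.End K V, ∃ X, Induced ψ X A)
    {t : (V ⊗[K] V) ⊗[K] V} (ht : bracket₃ ψ t = 0) (ξ η ζ : Module.Dual K V) (u v w : V) :
    (eval₃ ξ η ζ t - eval₃ η ξ ζ t) • ⁅⁅ψ u, ψ v⁆, ψ w⁆ +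
      (eval₃ η ζ ξ t - eval₃ ζ η ξ t) • ⁅⁅ψ v, ψ w⁆, ψ u⁆ +
      (eval₃ ζ ξ η t - eval₃ ξ ζ η t) • ⁅⁅ψ w, ψ u⁆, ψ v⁆ = 0 := by
  choose X hX using hψ
  let A : Module.End K V := ξ.smulRight u
  let B : Module.End K V := η.smulRight v
  let C : Module.End K V := ζ.smulRight w
  have key : ∀ t, ⁅X A, ⁅X B, ⁅X C, bracket₃ ψ t⁆⁆⁆ - ⁅X A, ⁅X (B * C), bracket₃ ψ t⁆⁆
      - ⁅X (A * B), ⁅X C, bracket₃ ψ t⁆⁆ + ⁅X (A * B * C), bracket₃ ψ t⁆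
      - ⁅X B, ⁅X (A * C), bracket₃ ψ t⁆⁆ + ⁅X (B * A * C), bracket₃ ψ t⁆ =
      (eval₃ ξ η ζ t - eval₃ η ξ ζ t) • ⁅⁅ψ u, ψ v⁆, ψ w⁆ +
      (eval₃ η ζ ξ t - eval₃ ζ η ξ t) • ⁅⁅ψ v, ψ w⁆, ψ u⁆ +
      (eval₃ ζ ξ η t - eval₃ ξ ζ η t) • ⁅⁅ψ w, ψ u⁆, ψ v⁆ := by
    intro t
    induction t with
    | zero => simp
    | tmul t z =>
      induction t with
      | zero => simp
      | tmul x y =>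
        have h₁ : ⁅⁅ψ v, ψ u⁆, ψ w⁆ = -⁅⁅ψ u, ψ v⁆, ψ w⁆ := by rw [← lie_skew (ψ v), neg_lie]
        have h₂ : ⁅⁅ψ w, ψ v⁆, ψ u⁆ = -⁅⁅ψ v, ψ w⁆, ψ u⁆ := by rw [← lie_skew (ψ w), neg_lie]
        have h₃ : ⁅⁅ψ u, ψ w⁆, ψ v⁆ = -⁅⁅ψ w, ψ u⁆, ψ v⁆ := by rw [← lie_skew (ψ u), neg_lie]
        have expand : ∀ x y z, ⁅X A, ⁅X B, ⁅X C, ⁅⁅ψ x, ψ y⁆, ψ z⁆⁆⁆⁆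
            - ⁅X A, ⁅X (B * C), ⁅⁅ψ x, ψ y⁆, ψ z⁆⁆⁆
            - ⁅X (A * B), ⁅X C, ⁅⁅ψ x, ψ y⁆, ψ z⁆⁆⁆ + ⁅X (A * B * C), ⁅⁅ψ x, ψ y⁆, ψ z⁆⁆
            - ⁅X B, ⁅X (A * C), ⁅⁅ψ x, ψ y⁆, ψ z⁆⁆⁆ + ⁅X (B * A * C), ⁅⁅ψ x, ψ y⁆, ψ z⁆⁆ =
            ⁅⁅ψ (A x), ψ (B y)⁆, ψ (C z)⁆ + ⁅⁅ψ (B x), ψ (A y)⁆, ψ (C z)⁆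
            + ⁅⁅ψ (A x), ψ (C y)⁆, ψ (B z)⁆ + ⁅⁅ψ (C x), ψ (A y)⁆, ψ (B z)⁆
            + ⁅⁅ψ (B x), ψ (C y)⁆, ψ (A z)⁆ + ⁅⁅ψ (C x), ψ (B y)⁆, ψ (A z)⁆ := by
          intro x y z
          simp only [(hX _).lie₃, lie_add, Module.End.mul_apply]
          abel
        simp only [bracket₃_tmul, bracket₂_tmul, eval₃_tmul, eval₂_tmul, expand]
        simp only [A, B, C, LinearMap.smulRight_apply, map_smul, smul_lie, lie_smul, h₁, h₂, h₃]
        module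
      | add x y hx hy =>
        simp only [TensorProduct.add_tmul, map_add, lie_add]
        linear_combination (norm := module) hx + hy
    | add x y hx hy =>
      simp only [map_add, lie_add]
      linear_combination (norm := module) hx + hy
  simpa [ht] using (key t).symm

/-- Nonvanishing of triple brackets is already detected on brackets `⁅⁅u, v⁆, u⁆`. -/
lemma exists_lie_lie_self_ne_zero [CharZero K] (h : bracket₃ ψ ≠ 0) :
    ∃ u v, ⁅⁅ψ u, ψ v⁆, ψ u⁆ ≠ 0 := by
  by_contra! h₀
  refine h (TensorProduct.ext_threefold fun u v w ↦ ?_)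
  have polar : ∀ u v w, ⁅⁅ψ u, ψ v⁆, ψ w⁆ = ⁅⁅ψ v, ψ w⁆, ψ u⁆ := by
    intro u v w
    have h₁ := h₀ (u + w) v
    simp only [map_add, add_lie, lie_add, h₀, zero_add, add_zero] at h₁
    rw [← lie_skew (ψ v) (ψ w), neg_lie, eq_neg_iff_add_eq_zero, add_comm]
    exact h₁
  have jac : ⁅⁅ψ u, ψ v⁆, ψ w⁆ + ⁅⁅ψ v, ψ w⁆, ψ u⁆ + ⁅⁅ψ w, ψ u⁆, ψ v⁆ = 0 := by
    have := lie_jacobi (ψ u) (ψ v) (ψ w)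
    rw [← lie_skew _ ⁅ψ v, ψ w⁆, ← lie_skew _ ⁅ψ w, ψ u⁆, ← lie_skew _ ⁅ψ u, ψ v⁆] at this
    rw [← neg_eq_zero, ← this]
    abel
  rw [← polar v w u, ← polar u v w] at jac
  have : (3 : K) • ⁅⁅ψ u, ψ v⁆, ψ w⁆ = 0 := by
    rw [← jac]
    module
  simpa using this

variable {L' : Type*} [LieRing L'] [LieAlgebra K L'] [FiniteDimensional K V] [CharZero K]

lemma bracket₂_eq_zero (hψ : ∀ A : Module.End K V, ∃ X, Induced ψ X A) (hne : bracket₂ ψ ≠ 0)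
    (θ : V →ₗ[K] L') {t : V ⊗[K] V} (ht : bracket₂ ψ t = 0) : bracket₂ θ t = 0 := by
  obtain ⟨u, v, huv⟩ : ∃ u v, ⁅ψ u, ψ v⁆ ≠ 0 := by
    by_contra! h₀
    exact hne (TensorProduct.ext' fun u v ↦ by simpa using h₀ u v)
  have hsymm : t = TensorProduct.comm K V V t := by
    refine ext_eval₂ fun ξ η ↦ ?_
    have h := (smul_eq_zero.1 (eval₂_sub_smul hψ ht ξ η u v)).resolve_right huv
    have hc : ∀ t, eval₂ ξ η (TensorProduct.comm K V V t) = eval₂ η ξ t := by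
      intro t
      induction t with
      | zero => simp
      | tmul x y => simp [mul_comm]
      | add x y hx hy => simp [hx, hy]
    rw [hc]
    exact sub_eq_zero.1 h
  have hskew : ∀ t, bracket₂ θ (TensorProduct.comm K V V t) = -bracket₂ θ t := by
    intro t
    induction t with
    | zero => simp
    | tmul x y => simp
    | add x y hx hy => simp [hx, hy, add_comm]
  have h := hskew t
  rw [← hsymm] at h
  have h₂ : (2 : K) • bracket₂ θ t = 0 := by
    rw [two_smul]
    nth_rewrite 1 [h]
    exact neg_add_cancel _
  simpa using h₂

lemma bracket₃_eq_zero (hψ : ∀ A : Module.End K V, ∃ X, Induced ψ X A) (hne : bracket₃ ψ ≠ 0)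
    (θ : V →ₗ[K] L') {t : (V ⊗[K] V) ⊗[K] V} (ht : bracket₃ ψ t = 0) : bracket₃ θ t = 0 := by
  obtain ⟨u, v, huv⟩ := exists_lie_lie_self_ne_zero hne
  let swap : (V ⊗[K] V) ⊗[K] V →ₗ[K] (V ⊗[K] V) ⊗[K] V :=
    (TensorProduct.comm K V V).toLinearMap.rTensor V
  let rot : (V ⊗[K] V) ⊗[K] V →ₗ[K] (V ⊗[K] V) ⊗[K] V :=
    (TensorProduct.comm K V (V ⊗[K] V)).toLinearMap ∘ₗ (TensorProduct.assoc K V V V).toLinearMap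
  have hswap : ∀ x y z, swap ((x ⊗ₜ y) ⊗ₜ z) = (y ⊗ₜ x) ⊗ₜ z := fun x y z ↦ by simp [swap]
  have hrot : ∀ x y z, rot ((x ⊗ₜ y) ⊗ₜ z) = (y ⊗ₜ z) ⊗ₜ x := fun x y z ↦ by simp [rot]
  have eval_swap : ∀ ξ η ζ : Module.Dual K V, eval₃ ξ η ζ ∘ₗ swap = eval₃ η ξ ζ := by
    intro ξ η ζ
    refine TensorProduct.ext_threefold fun x y z ↦ ?_
    simp [hswap, mul_comm]
  have eval_rot : ∀ ξ η ζ : Module.Dual K V, eval₃ ξ η ζ ∘ₗ rot = eval₃ ζ ξ η := by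
    intro ξ η ζ
    refine TensorProduct.ext_threefold fun x y z ↦ ?_
    simp only [LinearMap.comp_apply, hrot, eval₃_tmul, eval₂_tmul]
    ring
  have bracket_swap : bracket₃ θ ∘ₗ swap = -bracket₃ θ := by
    refine TensorProduct.ext_threefold fun x y z ↦ ?_
    simp only [LinearMap.comp_apply, hswap, LinearMap.neg_apply, bracket₃_tmul, bracket₂_tmul]
    rw [← lie_skew (θ y), neg_lie]
  have bracket_rot : bracket₃ θ + bracket₃ θ ∘ₗ rot + bracket₃ θ ∘ₗ rot ∘ₗ rot = 0 := by
    refine TensorProduct.ext_threefold fun x y z ↦ ?_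
    simp only [LinearMap.add_apply, LinearMap.comp_apply, hrot, bracket₃_tmul, bracket₂_tmul,
      LinearMap.zero_apply]
    have := lie_jacobi (θ x) (θ y) (θ z)
    rw [← lie_skew _ ⁅θ y, θ z⁆, ← lie_skew _ ⁅θ z, θ x⁆, ← lie_skew _ ⁅θ x, θ y⁆] at this
    rw [← neg_eq_zero, ← this]
    abel
  set s := t - swap t with hs
  have hcyc : rot s = s := by
    refine ext_eval₃ fun ξ η ζ ↦ ?_
    have h := eval₃_sub_smul hψ ht ζ ξ η u v u
    rw [lie_self, zero_lie, smul_zero, add_zero, ← lie_skew (ψ v) (ψ u), neg_lie, smul_neg,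
      ← sub_eq_add_neg, ← sub_smul] at h
    have h' := (smul_eq_zero.1 h).resolve_right huv
    simp only [← LinearMap.comp_apply, eval_rot]
    simp only [hs, map_sub]
    simp only [← LinearMap.comp_apply, eval_swap]
    exact sub_eq_zero.1 h'
  have h₁ : bracket₃ θ s = (2 : K) • bracket₃ θ t := by
    have := LinearMap.congr_fun bracket_swap t
    simp only [LinearMap.comp_apply, LinearMap.neg_apply] at this
    rw [hs, map_sub, this]
    module
  have h₂ := LinearMap.congr_fun bracket_rot s
  simp only [LinearMap.add_apply, LinearMap.comp_apply, hcyc, LinearMap.zero_apply, h₁] at h₂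
  have h₃ : (6 : K) • bracket₃ θ t = 0 := by
    rw [← h₂]
    module
  simpa using h₃

end LieTensor

namespace GLA

open LieTensor

variable {V L : Type} [AddCommGroup V] [Module ℂ V] [LieRing L] [LieAlgebra ℂ L] {G : GLA L}
  {ψ : V →ₗ[ℂ] L}

lemma lie_eq_zero_of_mem {p q : ℤ} (h : G.g (p + q) = ⊥) {x y : L} (hx : x ∈ G.g p)
    (hy : y ∈ G.g q) : ⁅x, y⁆ = 0 := by
  have := G.bracket_mem p q x hx y hy
  rwa [h, Submodule.mem_bot] at this

lemma IsOfKind.eq_bot {μ : ℕ} (h : G.IsOfKind μ) (hμ : μ ≤ 3) {p : ℤ} (hp : p < -3) :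
    G.g p = ⊥ :=
  h.2 p (by lia)

lemma range_bracket₂ (hG : G.IsFGLA) (hψ : LinearMap.range ψ = G.g (-1)) :
    LinearMap.range (bracket₂ ψ) = G.g (-2) := by
  have hmem : ∀ v, ψ v ∈ G.g (-1) := fun v ↦ hψ ▸ LinearMap.mem_range_self ψ v
  apply le_antisymm
  · rintro _ ⟨t, rfl⟩
    induction t with
    | zero => simp
    | tmul x y => simpa using G.bracket_mem (-1) (-1) _ (hmem x) _ (hmem y)
    | add x y hx hy => simpa using add_mem hx hy
  · have := hG.generated (-1) (by norm_num)
    norm_num at this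
    rw [this, Submodule.span_le, ← hψ]
    rintro _ ⟨_, ⟨x, rfl⟩, _, ⟨y, rfl⟩, rfl⟩
    exact ⟨x ⊗ₜ y, by simp⟩

lemma range_bracket₃ (hG : G.IsFGLA) (hψ : LinearMap.range ψ = G.g (-1)) :
    LinearMap.range (bracket₃ ψ) = G.g (-3) := by
  have hmem : ∀ v, ψ v ∈ G.g (-1) := fun v ↦ hψ ▸ LinearMap.mem_range_self ψ v
  have hmem₂ : ∀ t, bracket₂ ψ t ∈ G.g (-2) := fun t ↦
    range_bracket₂ hG hψ ▸ LinearMap.mem_range_self _ t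
  apply le_antisymm
  · rintro _ ⟨t, rfl⟩
    induction t with
    | zero => simp
    | tmul x y => simpa using G.bracket_mem (-2) (-1) _ (hmem₂ x) _ (hmem y)
    | add x y hx hy => simpa using add_mem hx hy
  · have := hG.generated (-2) (by norm_num)
    norm_num at this
    rw [this, Submodule.span_le, ← hψ, ← range_bracket₂ hG hψ]
    rintro _ ⟨_, ⟨x, rfl⟩, _, ⟨y, rfl⟩, rfl⟩
    exact ⟨x ⊗ₜ y, by simp⟩

lemma bracketSum_surjective (hG : G.IsFGLA) (hbot : ∀ p < -3, G.g p = ⊥)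
    (hψ : LinearMap.range ψ = G.g (-1)) : Function.Surjective (bracketSum ψ) := by
  rw [← LinearMap.range_eq_top, eq_top_iff, ← G.internal.submodule_iSup_eq_top]
  refine iSup_le fun p ↦ ?_
  obtain hp | rfl | rfl | rfl | hp : p < -3 ∨ p = -3 ∨ p = -2 ∨ p = -1 ∨ 0 ≤ p := by lia
  · simp [hbot p hp]
  · rw [← range_bracket₃ hG hψ]
    rintro _ ⟨t, rfl⟩
    exact ⟨(0, 0, t), by simp⟩
  · rw [← range_bracket₂ hG hψ]
    rintro _ ⟨t, rfl⟩
    exact ⟨(0, t, 0), by simp⟩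
  · rw [← hψ]
    rintro _ ⟨t, rfl⟩
    exact ⟨(t, 0, 0), by simp⟩
  · simp [hG.nonneg p hp]

lemma lie_bracketSum (hG : G.IsFGLA) (hbot : ∀ p < -3, G.g p = ⊥)
    (hψ : LinearMap.range ψ = G.g (-1)) (a a' : V) (b b' : V ⊗[ℂ] V)
    (c c' : (V ⊗[ℂ] V) ⊗[ℂ] V) :
    ⁅bracketSum ψ (a, b, c), bracketSum ψ (a', b', c')⁆ =
      bracketSum ψ (0, a ⊗ₜ a', b ⊗ₜ a' - b' ⊗ₜ a) := by
  have h₁ : ∀ v, ψ v ∈ G.g (-1) := fun v ↦ hψ ▸ LinearMap.mem_range_self ψ v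
  have h₂ : ∀ t, bracket₂ ψ t ∈ G.g (-2) := fun t ↦
    range_bracket₂ hG hψ ▸ LinearMap.mem_range_self _ t
  have h₃ : ∀ t, bracket₃ ψ t ∈ G.g (-3) := fun t ↦
    range_bracket₃ hG hψ ▸ LinearMap.mem_range_self _ t
  have h₁₃ : ∀ v t, ⁅ψ v, bracket₃ ψ t⁆ = 0 := fun v t ↦
    lie_eq_zero_of_mem (hbot _ (by norm_num)) (h₁ v) (h₃ t)
  have h₃₁ : ∀ v t, ⁅bracket₃ ψ t, ψ v⁆ = 0 := fun v t ↦
    lie_eq_zero_of_mem (hbot _ (by norm_num)) (h₃ t) (h₁ v)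
  have h₂₂ : ∀ s t, ⁅bracket₂ ψ s, bracket₂ ψ t⁆ = 0 := fun s t ↦
    lie_eq_zero_of_mem (hbot _ (by norm_num)) (h₂ s) (h₂ t)
  have h₂₃ : ∀ s t, ⁅bracket₂ ψ s, bracket₃ ψ t⁆ = 0 := fun s t ↦
    lie_eq_zero_of_mem (hbot _ (by norm_num)) (h₂ s) (h₃ t)
  have h₃₂ : ∀ s t, ⁅bracket₃ ψ s, bracket₂ ψ t⁆ = 0 := fun s t ↦
    lie_eq_zero_of_mem (hbot _ (by norm_num)) (h₃ s) (h₂ t)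
  have h₃₃ : ∀ s t, ⁅bracket₃ ψ s, bracket₃ ψ t⁆ = 0 := fun s t ↦
    lie_eq_zero_of_mem (hbot _ (by norm_num)) (h₃ s) (h₃ t)
  simp only [bracketSum_apply, add_lie, lie_add, h₁₃, h₃₁, h₂₂, h₂₃, h₃₂, h₃₃, map_sub,
    bracket₂_tmul, bracket₃_tmul, map_zero]
  rw [← lie_skew (ψ a) (bracket₂ ψ b')]
  abel

lemma eq_zero_of_sum_eq_zero {x y z : L} (hx : x ∈ G.g (-1)) (hy : y ∈ G.g (-2))
    (hz : z ∈ G.g (-3)) (h : x + (y + z) = 0) : x = 0 ∧ y = 0 ∧ z = 0 := by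
  have hd : DirectSum.of (fun p ↦ G.g p) (-1) ⟨x, hx⟩ +
      (DirectSum.of (fun p ↦ G.g p) (-2) ⟨y, hy⟩ +
        DirectSum.of (fun p ↦ G.g p) (-3) ⟨z, hz⟩) = 0 := by
    apply G.internal.injective
    simpa using h
  have h₁ := congrArg (fun f ↦ (f (-1) : L)) hd
  have h₂ := congrArg (fun f ↦ (f (-2) : L)) hd
  have h₃ := congrArg (fun f ↦ (f (-3) : L)) hd
  simp only [DirectSum.add_apply, DirectSum.of_apply] at h₁ h₂ h₃
  simp at h₁ h₂ h₃
  exact ⟨h₁, h₂, h₃⟩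

/-- Two compatible systems of brackets are related by a homomorphism as soon as every relation
satisfied by the first one is satisfied by the second one. -/
lemma exists_hom {L' : Type} [LieRing L'] [LieAlgebra ℂ L'] {G' : GLA L'} {θ : V →ₗ[ℂ] L'}
    (hG : G.IsFGLA) (hG' : G'.IsFGLA) (hbot : ∀ p < -3, G.g p = ⊥) (hbot' : ∀ p < -3, G'.g p = ⊥)
    (hψ : LinearMap.range ψ = G.g (-1)) (hθ : LinearMap.range θ = G'.g (-1))
    (h₁ : ∀ t, ψ t = 0 → θ t = 0) (h₂ : ∀ t, bracket₂ ψ t = 0 → bracket₂ θ t = 0)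
    (h₃ : ∀ t, bracket₃ ψ t = 0 → bracket₃ θ t = 0) :
    ∃ Φ : L →ₗ⁅ℂ⁆ L', ∀ t, Φ (bracketSum ψ t) = bracketSum θ t := by
  have hker : ∀ t, bracketSum ψ t = 0 → bracketSum θ t = 0 := by
    rintro ⟨a, b, c⟩ h
    rw [bracketSum_apply] at h ⊢
    obtain ⟨ha, hb, hc⟩ := eq_zero_of_sum_eq_zero (hψ ▸ LinearMap.mem_range_self ψ a)
      (range_bracket₂ hG hψ ▸ LinearMap.mem_range_self _ b)
      (range_bracket₃ hG hψ ▸ LinearMap.mem_range_self _ c) h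
    rw [h₁ a ha, h₂ b hb, h₃ c hc]
    simp
  have hsurj := bracketSum_surjective hG hbot hψ
  obtain ⟨s, hs⟩ := (bracketSum ψ).exists_rightInverse_of_surjective
    (LinearMap.range_eq_top.2 hsurj)
  have hΦ : ∀ t, bracketSum θ (s (bracketSum ψ t)) = bracketSum θ t := by
    intro t
    rw [← sub_eq_zero, ← map_sub]
    apply hker
    rw [map_sub, sub_eq_zero]
    exact LinearMap.congr_fun hs _
  refine ⟨{ bracketSum θ ∘ₗ s with map_lie' := ?_ }, hΦ⟩
  intro x y
  obtain ⟨⟨a, b, c⟩, rfl⟩ := hsurj x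
  obtain ⟨⟨a', b', c'⟩, rfl⟩ := hsurj y
  change bracketSum θ (s _) = ⁅bracketSum θ (s _), bracketSum θ (s _)⁆
  rw [lie_bracketSum hG hbot hψ, hΦ, hΦ, hΦ, lie_bracketSum hG' hbot' hθ]

lemma map_mem_of_bracketSum {L' : Type} [LieRing L'] [LieAlgebra ℂ L'] {G' : GLA L'}
    {θ : V →ₗ[ℂ] L'} (hG : G.IsFGLA) (hG' : G'.IsFGLA) (hbot : ∀ p < -3, G.g p = ⊥)
    (hψ : LinearMap.range ψ = G.g (-1)) (hθ : LinearMap.range θ = G'.g (-1))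
    {Φ : L →ₗ⁅ℂ⁆ L'} (hΦ : ∀ t, Φ (bracketSum ψ t) = bracketSum θ t) (p : ℤ) {x : L}
    (hx : x ∈ G.g p) : Φ x ∈ G'.g p := by
  obtain hp | rfl | rfl | rfl | hp : p < -3 ∨ p = -3 ∨ p = -2 ∨ p = -1 ∨ 0 ≤ p := by lia
  · rw [hbot p hp, Submodule.mem_bot] at hx
    simp [hx]
  · rw [← range_bracket₃ hG hψ] at hx
    obtain ⟨t, rfl⟩ := hx
    rw [← range_bracket₃ hG' hθ]
    exact ⟨t, by simpa using (hΦ (0, 0, t)).symm⟩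
  · rw [← range_bracket₂ hG hψ] at hx
    obtain ⟨t, rfl⟩ := hx
    rw [← range_bracket₂ hG' hθ]
    exact ⟨t, by simpa using (hΦ (0, t, 0)).symm⟩
  · rw [← hψ] at hx
    obtain ⟨t, rfl⟩ := hx
    rw [← hθ]
    exact ⟨t, by simpa using (hΦ (t, 0, 0)).symm⟩
  · rw [hG.nonneg p hp, Submodule.mem_bot] at hx
    simp [hx]

end GLA

/-- If the degree-zero part of the prolongation restricts onto `gl(g₋₁)`, then every endomorphism
of `g₋₁` is induced by an inner derivation of the prolongation. -/
lemma IsProlongation.exists_induced {Lm LG : Type} [LieRing Lm] [LieAlgebra ℂ Lm]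
    [LieRing LG] [LieAlgebra ℂ LG] {M : GLA Lm} {G : GLA LG} {ι : Lm →ₗ⁅ℂ⁆ LG}
    (h : IsProlongation M G ι) {Φ : (G.g 0) → Module.End ℂ (G.g (-1))}
    (hΦ : ∀ (X : G.g 0) (Y : G.g (-1)), ((Φ X) Y : LG) = ⁅(X : LG), (Y : LG)⁆)
    (hsurj : Function.Surjective Φ) (A : Module.End ℂ (M.g (-1))) :
    ∃ X, LieTensor.Induced (ι.toLinearMap ∘ₗ (M.g (-1)).subtype) X A := by
  let e : M.g (-1) ≃ₗ[ℂ] G.g (-1) :=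
    (Submodule.equivMapOfInjective ι.toLinearMap h.inj (M.g (-1))).trans
      (LinearEquiv.ofEq _ _ (h.graded_neg (-1) (by norm_num)))
  have he : ∀ v, (e v : LG) = ι v := fun v ↦ rfl
  obtain ⟨X, hX⟩ := hsurj (e.conj A)
  refine ⟨X, fun v ↦ ?_⟩
  have := hΦ X (e v)
  rw [hX] at this
  simpa [LinearEquiv.conj_apply, he] using this.symm

/-- If `m` is an FGLA of the `μ`-th kind with `μ = 2` or `μ = 3`, and the degree-zero
part of its prolongation is isomorphic to `gl(g₋₁)` via the restriction map, then `m`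
is a free FGLA. -/
theorem fgla_free_of_prolongation_gl {Lm LG : Type} [LieRing Lm] [LieAlgebra ℂ Lm]
    [LieRing LG] [LieAlgebra ℂ LG] (M : GLA Lm) (μ : ℕ) (hμ : μ = 2 ∨ μ = 3)
    (hM : M.IsFGLA) (hkind : M.IsOfKind μ)
    (G : GLA LG) (ι : Lm →ₗ⁅ℂ⁆ LG) (hprol : IsProlongation M G ι)
    (hgl : ∃ Φ : (G.g 0) → Module.End ℂ (G.g (-1)),
      (∀ (X : G.g 0) (Y : G.g (-1)), ((Φ X) Y : LG) = ⁅(X : LG), (Y : LG)⁆) ∧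
      Function.Bijective Φ) :
    IsFreeFGLA M (Module.finrank ℂ (M.g (-1))) μ := by
  obtain ⟨Ψ, hΨ, hbij⟩ := hgl
  refine ⟨hM, hkind, rfl, fun L' _ _ G' hG' hkind' φ hφ ↦ ?_⟩
  have hμ₃ : μ ≤ 3 := by lia
  have hbot : ∀ p < -3, M.g p = ⊥ := fun p ↦ hkind.eq_bot hμ₃
  have hbot' : ∀ p < -3, G'.g p = ⊥ := fun p ↦ hkind'.eq_bot hμ₃
  have := M.findim (-1)
  set ψ := (M.g (-1)).subtype with hψ_def
  set θ := (G'.g (-1)).subtype ∘ₗ φ with hθ_def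
  have hψ : LinearMap.range ψ = M.g (-1) := Submodule.range_subtype _
  have hθ : LinearMap.range θ = G'.g (-1) := by
    rw [hθ_def, LinearMap.range_comp, LinearMap.range_eq_top.2 hφ, Submodule.map_top,
      Submodule.range_subtype]
  have hind := hprol.exists_induced hΨ hbij.surjective
  have hne₃ : μ = 3 → LieTensor.bracket₃ ψ ≠ 0 := by
    rintro rfl h
    apply hkind.1
    rw [Nat.cast_ofNat, ← GLA.range_bracket₃ hM hψ, h, LinearMap.range_zero]
  have hne₂ : LieTensor.bracket₂ ψ ≠ 0 := by
    intro h
    obtain rfl | rfl := hμ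
    · apply hkind.1
      rw [Nat.cast_ofNat, ← GLA.range_bracket₂ hM hψ, h, LinearMap.range_zero]
    · refine hne₃ rfl (TensorProduct.ext' fun t z ↦ ?_)
      simp [h]
  have hι₂ : LieTensor.bracket₂ (ι.toLinearMap ∘ₗ ψ) ≠ 0 := fun h ↦ hne₂ <| LinearMap.ext
    fun t ↦ hprol.inj <| by simp [LieTensor.comp_bracket₂, h]
  have h₂ : ∀ t, LieTensor.bracket₂ ψ t = 0 → LieTensor.bracket₂ θ t = 0 := fun t ht ↦
    LieTensor.bracket₂_eq_zero hind hι₂ θ (by rw [← LieTensor.comp_bracket₂, ht, map_zero])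
  have h₃ : ∀ t, LieTensor.bracket₃ ψ t = 0 → LieTensor.bracket₃ θ t = 0 := by
    intro t ht
    obtain rfl | rfl := hμ
    · have hmem := LinearMap.mem_range_self (LieTensor.bracket₃ θ) t
      rwa [GLA.range_bracket₃ hG' hθ, hkind'.2 (-3) (by norm_num), Submodule.mem_bot] at hmem
    · have hι₃ : LieTensor.bracket₃ (ι.toLinearMap ∘ₗ ψ) ≠ 0 := fun h ↦ hne₃ rfl <|
        LinearMap.ext fun t ↦ hprol.inj <| by simp [LieTensor.comp_bracket₃, h]
      exact LieTensor.bracket₃_eq_zero hind hι₃ θ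
        (by rw [← LieTensor.comp_bracket₃, ht, map_zero])
  have h₁ : ∀ t, ψ t = 0 → θ t = 0 := fun t ht ↦ by
    rw [(Submodule.coe_eq_zero (x := t)).1 ht, map_zero]
  obtain ⟨Φ, hΦ⟩ := GLA.exists_hom hM hG' hbot hbot' hψ hθ h₁ h₂ h₃
  refine ⟨Φ, ⟨fun p x hx ↦ GLA.map_mem_of_bracketSum hM hG' hbot hψ hθ hΦ p hx, ?_, ?_⟩, ?_⟩
  · intro y
    obtain ⟨t, rfl⟩ := GLA.bracketSum_surjective hG' hbot' hθ y
    exact ⟨_, hΦ t⟩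
  · intro x
    simpa [ψ, θ] using hΦ (x, 0, 0)
  · rintro Φ' ⟨-, -, hΦ'⟩
    ext x
    obtain ⟨t, rfl⟩ := GLA.bracketSum_surjective hM hbot hψ x
    have hcomp : Φ'.toLinearMap ∘ₗ ψ = θ := LinearMap.ext hΦ'
    rw [hΦ, LieTensor.comp_bracketSum, hcomp]
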